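/- arXiv:1704.04759 — 2 statements merged into one kernel-verified Lean document; each statement's English description precedes it below -/
import Mathlib

section
/- Trace-level soundness of the Assume-Guarantee proof rule (Rule AG): Let p, q : ℕ → Prop be predicates on time ticks and let s₁, s₂ be positive natural numbers (update periods). Suppose (i) for every tick t divisible by s₁, if p holds at t then q holds at every tick t' with t ≤ t' ≤ t + s₁ (i.e., the triple ⟨M₁,s₁⟩ p {q} holds on the trace), and (ii) for every tick t divisible by s₂, p holds at every tick t' with t ≤ t' ≤ t + s₂ (i.e., the triple ⟨M₂,s₂⟩ true {p} holds on the trace). Then for every tick t divisible by s₁, q holds at every tick t' with t ≤ t' ≤ t + s₁ (i.e., the triple ⟨M₁∥M₂,s₁⟩ true {q} holds on the trace). -/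
/-- Trace-level soundness of the Assume-Guarantee proof rule (Rule AG). -/
theorem ag_rule_sound (p q : ℕ → Prop) (s₁ s₂ : ℕ) (hs₁ : 0 < s₁) (hs₂ : 0 < s₂)
    (h₁ : ∀ t : ℕ, s₁ ∣ t → p t → ∀ t' : ℕ, t ≤ t' → t' ≤ t + s₁ → q t')
    (h₂ : ∀ t : ℕ, s₂ ∣ t → ∀ t' : ℕ, t ≤ t' → t' ≤ t + s₂ → p t') :
    ∀ t : ℕ, s₁ ∣ t → ∀ t' : ℕ, t ≤ t' → t' ≤ t + s₁ → q t' := by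
  intro t ht
  refine h₁ t ht (h₂ (s₂ * (t / s₂)) (dvd_mul_right _ _) t (Nat.mul_div_le t s₂) ?_)
  have := Nat.mod_lt t hs₂
  have := Nat.div_add_mod t s₂
  lia
end

section
/- Energy-safety invariance (core of Theorem 2): Let E_MP, E₁₈₀, BE_MP, ε be real numbers and let B, BE, FE, seg : ℕ → ℝ and c : ℕ → Bool be sequences, where c n = true means the recharge (baseline) controller is active at Mission Planning decision point n. Define E n := BE n if c n = true, and E n := E₁₈₀ + BE n otherwise. Assume for every n: (a) if c (n+1) = true then B (n+1) = B n − (if c n = true then 0 else E₁₈₀) − seg n and BE n = seg n + BE (n+1); and (b) if c (n+1) = false then B (n+1) ≥ B n − E_MP, B n > E_MP + E₁₈₀ + BE_MP + (1 + ε)·FE n, BE n ≤ (1 + ε)·FE n, and BE (n+1) ≤ BE_MP + BE n. Then B 0 > E 0 implies B n > E n for all n ∈ ℕ, i.e., the rover always has enough energy to return to the last-visited power station. -/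
/-- Energy-safety invariance (core of Theorem 2). -/
theorem es_invariance (E_MP E₁₈₀ BE_MP ε : ℝ)
    (B BE FE seg : ℕ → ℝ) (c : ℕ → Bool)
    (E : ℕ → ℝ) (hE : ∀ n, E n = if c n = true then BE n else E₁₈₀ + BE n)
    (ha : ∀ n, c (n + 1) = true →
      B (n + 1) = B n - (if c n = true then 0 else E₁₈₀) - seg n ∧
      BE n = seg n + BE (n + 1))
    (hb : ∀ n, c (n + 1) = false →
      B (n + 1) ≥ B n - E_MP ∧
      B n > E_MP + E₁₈₀ + BE_MP + (1 + ε) * FE n ∧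
      BE n ≤ (1 + ε) * FE n ∧
      BE (n + 1) ≤ BE_MP + BE n)
    (h0 : B 0 > E 0) :
    ∀ n : ℕ, B n > E n := by
  intro n
  induction n with
  | zero => exact h0
  | succ n ih =>
    rw [hE] at ih ⊢
    cases hc : c (n + 1) with
    | true =>
      obtain ⟨hB, hBE⟩ := ha n hc
      rw [if_pos rfl]
      split_ifs at ih hB <;> linarith
    | false =>
      obtain ⟨hB, hgt, hBE, hstep⟩ := hb n hc
      rw [if_neg Bool.false_ne_true]
      linarith
end
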